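/- In the setting of part (2) of Yang–Stufken's complete class theorem, suppose additionally that k is odd and that the index of ξ satisfies I(ξ) ≥ k/2. Then the improving design ξ⁻ can be chosen to have at most (k+1)/2 support points, with A a support point of ξ⁻; that is, there exists a finitely supported probability measure ξ⁻ on [A,B] with at most (k+1)/2 support points, A ∈ supp(ξ⁻), ∫_A^B Ψ_i dξ⁻ = ∫_A^B Ψ_i dξ for all i = 0,…,k−1, and ∫_A^B C₂₂ dξ⁻ − ∫_A^B C₂₂ dξ positive semidefinite. -/

import Mathlib

open MeasureTheory Set Matrix

/-- A family of functions `Ψ₀, …, Ψ_{k-1}` is a Chebyshev system on `[A,B]` if for all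
points `A ≤ x₀ < x₁ < ⋯ < x_{k-1} ≤ B` the matrix `(Ψ i (x j))` has positive determinant. -/
def IsChebyshevSystem (A B : ℝ) {k : ℕ} (Ψ : Fin k → ℝ → ℝ) : Prop :=
  ∀ x : Fin k → ℝ, StrictMono x → (∀ j, x j ∈ Set.Icc A B) →
    0 < (Matrix.of fun i j : Fin k => Ψ i (x j)).det

/-- `ξ` is a design on `[A,B]`: a finitely supported probability measure
`ξ = ∑_{x ∈ s} w_x δ_x` with support points `s ⊆ [A,B]` and positive weights. -/
def IsDesignOn (A B : ℝ) (ξ : Measure ℝ) (s : Finset ℝ) : Prop :=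
  IsProbabilityMeasure ξ ∧ ↑s ⊆ Set.Icc A B ∧ (∀ x ∈ s, 0 < ξ {x}) ∧
    ξ = ∑ x ∈ s, ξ {x} • Measure.dirac x

/-- The entrywise integral `∫ C₂₂(x) dξ(x)` of a matrix-valued function. -/
noncomputable def matrixIntegral {p₁ : ℕ} (C : ℝ → Matrix (Fin p₁) (Fin p₁) ℝ)
    (ξ : Measure ℝ) : Matrix (Fin p₁) (Fin p₁) ℝ :=
  Matrix.of fun a b => ∫ x, C x a b ∂ξ

open Classical in
/-- The index of a design with support `s` on `[A,B]`: the number of support points in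
the open interval `(A,B)` plus one half times the number of support points among the
endpoints `{A, B}`. -/
noncomputable def designIndex (A B : ℝ) (s : Finset ℝ) : ℝ :=
  ((s.filter fun x => x ∈ Set.Ioo A B).card : ℝ) +
    ((s.filter fun x => x = A ∨ x = B).card : ℝ) / 2

/-- In a finite-dimensional space the convex hull of a compact set is compact. -/
theorem IsCompact.convexHull_of_finiteDimensional {E : Type*} [NormedAddCommGroup E]
    [NormedSpace ℝ E] [FiniteDimensional ℝ E] {s : Set E} (hs : IsCompact s) :
    IsCompact (convexHull ℝ s) := by
  rcases s.eq_empty_or_nonempty with rfl | ⟨x₀, hx₀⟩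
  · simp
  set N := Module.finrank ℝ E + 1
  have himage : convexHull ℝ s = (fun p : (Fin N → ℝ) × (Fin N → E) => ∑ i, p.1 i • p.2 i) ''
      (stdSimplex ℝ (Fin N) ×ˢ Set.univ.pi fun _ => s) := by
    apply Set.Subset.antisymm
    · intro x hx
      obtain ⟨ι, _, z, w, hz, hind, hw, hw1, hwz⟩ := eq_pos_convex_span_of_mem_convexHull hx
      have hcard : Fintype.card ι ≤ Fintype.card (Fin N) := by
        rw [Fintype.card_fin]
        exact hind.card_le_finrank_succ.trans
          (Nat.add_le_add_right (Submodule.finrank_le _) 1)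
      obtain ⟨e⟩ := Function.Embedding.nonempty_of_card_le hcard
      refine ⟨(Function.extend e w fun _ => 0, Function.extend e z fun _ => x₀), ⟨⟨?_, ?_⟩, ?_⟩, ?_⟩
      · intro j
        by_cases hj : ∃ i, e i = j
        · obtain ⟨i, rfl⟩ := hj
          simpa [e.injective.extend_apply] using (hw i).le
        · simp [Function.extend_apply' _ _ _ hj]
      · rw [← hw1]
        exact (Fintype.sum_of_injective e e.injective w (Function.extend e w fun _ => 0)
          (fun j hj => Function.extend_apply' _ _ _ hj)
          (fun i => (e.injective.extend_apply _ _ _).symm)).symm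
      · intro j _
        by_cases hj : ∃ i, e i = j
        · obtain ⟨i, rfl⟩ := hj
          simpa [e.injective.extend_apply] using hz ⟨i, rfl⟩
        · simpa [Function.extend_apply' _ _ _ hj] using hx₀
      · rw [← hwz]
        refine (Fintype.sum_of_injective e e.injective _ _ (fun j hj => ?_) (fun i => ?_)).symm
        · simp [Function.extend_apply' _ _ _ hj]
        · simp [e.injective.extend_apply]
    · rintro _ ⟨⟨w, z⟩, ⟨hw, hz⟩, rfl⟩
      exact mem_convexHull_of_exists_fintype w z hw.1 hw.2 (fun i => hz i trivial) rfl
  rw [himage]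
  exact ((isCompact_stdSimplex ℝ _).prod (isCompact_univ_pi fun _ => hs)).image (by fun_prop)

/-- The points of the convex hull of `f '' s` are the finite convex combinations
`∑ w x • f x` over points of `s`, with positive weights. -/
theorem mem_convexHull_image_iff {α E : Type*} [AddCommGroup E] [Module ℝ E]
    {f : α → E} {s : Set α} {v : E} :
    v ∈ convexHull ℝ (f '' s) ↔ ∃ (S : Finset α) (w : α → ℝ), ↑S ⊆ s ∧ (∀ x ∈ S, 0 < w x) ∧
      ∑ x ∈ S, w x = 1 ∧ ∑ x ∈ S, w x • f x = v := by
  classical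
  constructor
  · intro hv
    obtain ⟨ι, _, w, z, hw, hw1, hz, hwz⟩ := mem_convexHull_iff_exists_fintype.1 hv
    choose x hxs hxz using hz
    have hpush :
        ∑ y ∈ (Finset.univ.image x).filter (fun y => 0 < ∑ i with x i = y, w i),
          (∑ i with x i = y, w i) • f y = ∑ i, w i • f (x i) := by
      rw [Finset.sum_filter_of_ne, ← Finset.sum_fiberwise_of_maps_to (s := Finset.univ)
        (t := Finset.univ.image x) (g := x) (fun i _ => Finset.mem_image_of_mem _ (Finset.mem_univ i))]
      · refine Finset.sum_congr rfl fun y _ => ?_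
        rw [Finset.sum_smul]
        refine Finset.sum_congr rfl fun i hi => ?_
        rw [(Finset.mem_filter.1 hi).2]
      · intro y _ hy
        refine lt_of_le_of_ne (Finset.sum_nonneg fun i _ => hw i) fun h => hy ?_
        rw [← h, zero_smul]
    refine ⟨(Finset.univ.image x).filter (fun y => 0 < ∑ i with x i = y, w i),
      fun y => ∑ i with x i = y, w i, ?_, fun y hy => (Finset.mem_filter.1 hy).2, ?_, ?_⟩
    · intro y hy
      obtain ⟨i, -, rfl⟩ := Finset.mem_image.1 (Finset.mem_filter.1 hy).1
      exact hxs i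
    · rw [Finset.sum_filter_of_ne, Finset.sum_fiberwise_of_maps_to (s := Finset.univ) (g := x), hw1]
      · exact fun i _ => Finset.mem_image_of_mem _ (Finset.mem_univ i)
      · exact fun y _ hy => lt_of_le_of_ne (Finset.sum_nonneg fun i _ => hw i) (Ne.symm hy)
    · rw [hpush]
      simpa [hxz] using hwz
  · rintro ⟨S, w, hS, hw, hw1, rfl⟩
    exact (convex_convexHull ℝ _).sum_mem (fun x hx => (hw x hx).le) hw1
      fun x hx => subset_convexHull ℝ _ ⟨x, hS hx, rfl⟩

theorem Finset.card_filter_orderEmbOfFin_lt {α : Type*} [LinearOrder α] {n : ℕ} (Z : Finset α)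
    (hZ : Z.card = n) (j : Fin n) :
    (Z.filter (Z.orderEmbOfFin hZ j < ·)).card = n - 1 - j := by
  rw [← Fin.card_Ioi, ← Finset.card_map (Z.orderEmbOfFin hZ).toEmbedding]
  congr 1
  ext x
  simp only [Finset.mem_filter, Finset.mem_map, Finset.mem_Ioi, RelEmbedding.coe_toEmbedding]
  constructor
  · rintro ⟨hx, hlt⟩
    obtain ⟨i, rfl⟩ : x ∈ Set.range (Z.orderEmbOfFin hZ) := by simpa using hx
    exact ⟨i, by simpa using hlt, rfl⟩
  · rintro ⟨i, hi, rfl⟩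
    exact ⟨Finset.orderEmbOfFin_mem _ _ _, by simpa using hi⟩

/-- Interpolation in a Chebyshev system: a combination of the functions vanishes at
prescribed points `Z`, and is positive wherever the number of larger points of `Z` is even. -/
theorem IsChebyshevSystem.exists_combination {A B : ℝ} {n : ℕ} {F : Fin (n + 1) → ℝ → ℝ}
    (hF : IsChebyshevSystem A B F) (Z : Finset ℝ) (hZ : Z.card = n) (hZs : ↑Z ⊆ Set.Icc A B) :
    ∃ c : Fin (n + 1) → ℝ,
      (IsChebyshevSystem A B (fun i : Fin n => F i.castSucc) → 0 < c (Fin.last n)) ∧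
      (∀ x ∈ Z, ∑ i, c i * F i x = 0) ∧
      ∀ x ∈ Set.Icc A B, x ∉ Z → Even (Z.filter (x < ·)).card → 0 < ∑ i, c i * F i x := by
  set z := Z.orderEmbOfFin hZ
  have hz : ∀ j, z j ∈ Z := fun j => Finset.orderEmbOfFin_mem _ _ _
  set c : Fin (n + 1) → ℝ := fun i =>
    (-1) ^ (n + i : ℕ) * (Matrix.of fun a b => F (i.succAbove a) (z b)).det
  have hexp : ∀ (p : Fin (n + 1)) (y : Fin (n + 1) → ℝ), (∀ j, y (p.succAbove j) = z j) →
      ∑ i, c i * F i (y p) =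
        (-1) ^ (n + p : ℕ) * (Matrix.of fun i j => F i (y j)).det := by
    intro p y hy
    rw [Matrix.det_succ_column _ p, Finset.mul_sum]
    refine Finset.sum_congr rfl fun i _ => ?_
    have hsub : (Matrix.of fun i j => F i (y j)).submatrix i.succAbove p.succAbove =
        Matrix.of fun a b => F (i.succAbove a) (z b) := by
      ext a b
      simp [hy]
    have hsign : (-1 : ℝ) ^ (n + p : ℕ) * (-1) ^ (i + p : ℕ) = (-1) ^ (n + i : ℕ) := by
      rw [← pow_add, show n + (p : ℕ) + (i + p) = (n + i) + 2 * p by ring, pow_add, pow_mul]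
      simp
    rw [hsub]
    simp only [Matrix.of_apply, c]
    rw [← hsign]
    ring
  refine ⟨c, fun hF' => ?_, fun x hx => ?_, fun x hxs hx heven => ?_⟩
  · have := hF' z z.strictMono fun j => hZs (hz j)
    simpa [c, ← two_mul, pow_mul] using this
  · obtain ⟨j, rfl⟩ : x ∈ Set.range z := by simpa [z] using hx
    have := hexp 0 (Fin.cons (z j) z) (by simp)
    rw [Matrix.det_zero_of_column_eq (Fin.succ_ne_zero j).symm (by simp)] at this
    simpa using this
  · have hT : (insert x Z).card = n + 1 := by rw [Finset.card_insert_of_notMem hx, hZ]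
    set y := (insert x Z).orderEmbOfFin hT
    obtain ⟨p, hp⟩ : x ∈ Set.range y := by simp [y]
    have hyz : (fun j => y (p.succAbove j)) = z := by
      refine Finset.orderEmbOfFin_unique hZ (fun j => ?_)
        (y.strictMono.comp (Fin.strictMono_succAbove p))
      have h1 : y (p.succAbove j) ∈ insert x Z := Finset.orderEmbOfFin_mem _ _ _
      refine Finset.mem_of_mem_insert_of_ne h1 fun h2 => ?_
      exact Fin.succAbove_ne p j (y.injective (h2.trans hp.symm))
    have hcard := Finset.card_filter_orderEmbOfFin_lt _ hT p
    change ((insert x Z).filter (y p < ·)).card = _ at hcard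
    rw [hp, Finset.filter_insert, if_neg (lt_irrefl x), Nat.add_sub_cancel] at hcard
    have hpos := hF y y.strictMono fun j => by
      have h1 : y j ∈ insert x Z := Finset.orderEmbOfFin_mem _ _ _
      rcases Finset.mem_insert.1 h1 with h2 | h2
      · rwa [h2]
      · exact hZs h2
    have heq := hexp p y (congrFun hyz)
    have hsgn : Even (n + p : ℕ) := by
      have := p.is_le
      rw [hcard] at heven
      rw [show n + (p : ℕ) = (n - p) + 2 * p by omega]
      exact heven.add (even_two_mul _)
    rw [hp, hsgn.neg_one_pow, one_mul] at heq
    rwa [heq]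

/-- Given `k + 1` points, there is an alternating signed measure on them that annihilates a
Chebyshev system of `k` functions and is negative on a further function extending the system. -/
theorem IsChebyshevSystem.exists_annihilator {A B : ℝ} {k : ℕ} {Ψ : Fin k → ℝ → ℝ} {u : ℝ → ℝ}
    (hΨ : IsChebyshevSystem A B Ψ) (hu : IsChebyshevSystem A B (Fin.snoc Ψ u)) (Z : Finset ℝ)
    (hZ : Z.card = k + 1) (hZs : ↑Z ⊆ Set.Icc A B) :
    ∃ σ : ℝ → ℝ, (∀ x ∈ Z, Odd (Z.filter (x < ·)).card → 0 < σ x) ∧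
      (∀ i, ∑ x ∈ Z, σ x * Ψ i x = 0) ∧ ∑ x ∈ Z, σ x * u x < 0 := by
  set z := Z.orderEmbOfFin hZ
  have hz : ∀ j, z j ∈ Z := fun j => Finset.orderEmbOfFin_mem _ _ _
  set τ : Fin (k + 1) → ℝ := fun j =>
    -((-1) ^ (k + j : ℕ) * (Matrix.of fun a b => Ψ a (z (j.succAbove b))).det)
  have hτ : ∀ φ : ℝ → ℝ, ∑ j, τ j * φ (z j) =
      -(Matrix.of fun i j => (Fin.snoc Ψ φ : Fin (k + 1) → ℝ → ℝ) i (z j)).det := by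
    intro φ
    rw [Matrix.det_succ_row _ (Fin.last k), ← Finset.sum_neg_distrib]
    refine Finset.sum_congr rfl fun j _ => ?_
    have hsub : (Matrix.of fun i j => (Fin.snoc Ψ φ : Fin (k + 1) → ℝ → ℝ) i (z j)).submatrix
        (Fin.last k).succAbove j.succAbove = Matrix.of fun a b => Ψ a (z (j.succAbove b)) := by
      ext a b
      simp
    rw [hsub]
    simp [τ]
    ring
  set σ : ℝ → ℝ := Function.extend z τ 0
  have hσ : ∀ j, σ (z j) = τ j := fun j => z.injective.extend_apply _ _ _
  have hsum : ∀ φ : ℝ → ℝ, ∑ x ∈ Z, σ x * φ x = ∑ j, τ j * φ (z j) := by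
    intro φ
    rw [← Finset.map_orderEmbOfFin_univ Z hZ, Finset.sum_map]
    exact Finset.sum_congr rfl fun j _ => by
      change σ (z j) * φ (z j) = _
      rw [hσ]
  refine ⟨σ, fun x hx hodd => ?_, fun i => ?_, ?_⟩
  · obtain ⟨j, rfl⟩ : x ∈ Set.range z := by simpa [z] using hx
    rw [Finset.card_filter_orderEmbOfFin_lt, Nat.add_sub_cancel] at hodd
    have hsgn : Odd (k + j : ℕ) := by
      have := j.is_le
      rw [show k + (j : ℕ) = (k - j) + 2 * j by omega]
      exact hodd.add_even (even_two_mul _)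
    have hpos := hΨ (fun b => z (j.succAbove b)) (z.strictMono.comp (Fin.strictMono_succAbove j))
      fun b => hZs (hz _)
    rw [hσ]
    simpa [τ, hsgn.neg_one_pow] using hpos
  · rw [hsum, hτ, neg_eq_zero]
    refine Matrix.det_zero_of_row_eq (Fin.castSucc_lt_last i).ne ?_
    ext j
    simp
  · rw [hsum, hτ, neg_lt_zero]
    exact hu z z.strictMono fun j => hZs (hz j)

/-- Every finite set `X ⊆ (A, B]` can be doubled to a finite set `Z ⊆ (A, B]` such that the points
of `X`, as well as those of a prescribed finite set `T`, have an even number of larger points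
in `Z`, and the added points have an odd number of larger points in `Z`. -/
theorem exists_doubling {A B : ℝ} (X : Finset ℝ) (hX : ↑X ⊆ Set.Ioc A B) (T : Finset ℝ) :
    ∃ Z : Finset ℝ, X ⊆ Z ∧ ↑Z ⊆ Set.Ioc A B ∧ Z.card = 2 * X.card ∧
      (∀ t ∈ T ∪ X, Even (Z.filter (t < ·)).card) ∧
      ∀ t ∈ Z, t ∉ X → Odd (Z.filter (t < ·)).card := by
  induction X using Finset.induction_on generalizing T with
  | empty => exact ⟨∅, by simp⟩
  | insert x X hxX ih =>
    rw [Finset.coe_insert, Set.insert_subset_iff] at hX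
    obtain ⟨Z, hXZ, hZs, hZc, heven, hodd⟩ := ih hX.2 (insert x T)
    have hxZ : x ∉ Z := fun h =>
      Nat.not_even_iff_odd.2 (hodd x h hxX) (heven x (by simp))
    obtain ⟨y, hAy, hyx, hy⟩ : ∃ y, A < y ∧ y < x ∧ ∀ t ∈ T ∪ Z, t < x → t < y := by
      set R := (insert A (T ∪ Z)).filter (· < x)
      have hA : A ∈ R := by simp [R, hX.1.1]
      obtain ⟨y, hy1, hy2⟩ := exists_between
        (Finset.mem_filter.1 (R.max'_mem ⟨A, hA⟩)).2
      exact ⟨y, (R.le_max' A hA).trans_lt hy1, hy2, fun t ht htx =>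
        (R.le_max' t (Finset.mem_filter.2 ⟨Finset.mem_insert_of_mem ht, htx⟩)).trans_lt hy1⟩
    have hyZ : y ∉ Z := fun h => lt_irrefl y (hy y (Finset.mem_union_right _ h) hyx)
    have hyins : y ∉ insert x Z := by simp [hyx.ne, hyZ]
    have hcount : ∀ t ∈ T ∪ Z, t ≠ x → ∃ e, Even e ∧
        ((insert y (insert x Z)).filter (t < ·)).card = (Z.filter (t < ·)).card + e := by
      intro t ht htx
      rcases lt_or_gt_of_ne htx with h | h
      · refine ⟨2, even_two, ?_⟩
        rw [Finset.filter_insert, if_pos (hy t ht h), Finset.filter_insert, if_pos h,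
          Finset.card_insert_of_notMem (by simp [hyx.ne, hyZ]),
          Finset.card_insert_of_notMem (by simp [hxZ])]
      · refine ⟨0, Even.zero, ?_⟩
        rw [Finset.filter_insert, if_neg (by linarith), Finset.filter_insert, if_neg (by linarith)]
        rfl
    have hcx : ((insert y (insert x Z)).filter (x < ·)).card = (Z.filter (x < ·)).card := by
      rw [Finset.filter_insert, if_neg (by linarith), Finset.filter_insert, if_neg (by linarith)]
    have hcy : ((insert y (insert x Z)).filter (y < ·)).card = (Z.filter (x < ·)).card + 1 := by
      rw [Finset.filter_insert, if_neg (by linarith), Finset.filter_insert, if_pos hyx,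
        Finset.card_insert_of_notMem (by simp [hxZ])]
      congr 2
      refine Finset.filter_congr fun t ht => ⟨fun h => ?_, fun h => hyx.trans h⟩
      by_contra hle
      rcases (not_lt.1 hle).lt_or_eq with h1 | rfl
      · exact lt_asymm h (hy t (Finset.mem_union_right _ ht) h1)
      · exact hxZ ht
    have hevenx : Even (Z.filter (x < ·)).card := heven x (by simp)
    refine ⟨insert y (insert x Z), ?_, ?_, ?_, ?_, ?_⟩
    · exact (Finset.insert_subset_insert _ hXZ).trans (Finset.subset_insert _ _)
    · rw [Finset.coe_insert, Finset.coe_insert, Set.insert_subset_iff, Set.insert_subset_iff]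
      exact ⟨⟨hAy, hyx.le.trans hX.1.2⟩, hX.1, hZs⟩
    · rw [Finset.card_insert_of_notMem hyins, Finset.card_insert_of_notMem hxZ,
        Finset.card_insert_of_notMem hxX, hZc]
      ring
    · intro t ht
      by_cases htx : t = x
      · rw [htx, hcx]
        exact hevenx
      · have htT : t ∈ T ∪ X := by simpa [htx] using ht
        obtain ⟨e, he, h⟩ := hcount t (Finset.union_subset_union_right hXZ htT) htx
        rw [h]
        refine (heven t ?_).add he
        simp only [Finset.mem_union, Finset.mem_insert] at htT ⊢
        tauto
    · intro t ht htX
      rw [Finset.mem_insert, not_or] at htX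
      rcases Finset.mem_insert.1 ht with rfl | ht
      · rw [hcy]
        exact hevenx.add_one
      · have htZ := Finset.mem_of_mem_insert_of_ne ht htX.1
        obtain ⟨e, he, h⟩ := hcount t (Finset.mem_union_right _ htZ) htX.1
        rw [h]
        exact (hodd t htZ htX.2).add_even he

theorem sum_mul_combination {ι α : Type*} [Fintype ι] (s : Finset α) (w : α → ℝ) (c : ι → ℝ)
    (F : ι → α → ℝ) :
    ∑ x ∈ s, w x * ∑ i, c i * F i x = ∑ i, c i * ∑ x ∈ s, w x * F i x := by
  simp only [Finset.mul_sum]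
  rw [Finset.sum_comm]
  exact Finset.sum_congr rfl fun i _ => Finset.sum_congr rfl fun x _ => mul_left_comm _ _ _

theorem exists_superset_card_eq_of_subset_Ioc {A B : ℝ} (hAB : A < B) {n : ℕ} (S : Finset ℝ)
    (hS : ↑S ⊆ Set.Ioc A B) (hn : S.card ≤ n) :
    ∃ X : Finset ℝ, S ⊆ X ∧ ↑X ⊆ Set.Ioc A B ∧ X.card = n := by
  obtain ⟨R, hR, hRc⟩ := (Set.Ioc_infinite hAB).exists_subset_card_eq n
  obtain ⟨X, hSX, hX, hXc⟩ := Finset.exists_subsuperset_card_eq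
    (Finset.subset_union_left (s₁ := S) (s₂ := R)) hn
    (hRc.ge.trans (Finset.card_le_card Finset.subset_union_right))
  refine ⟨X, hSX, fun x hx => ?_, hXc⟩
  rcases Finset.mem_union.1 (hX hx) with h | h
  · exact hS h
  · exact hR h

/-- Among the finitely supported probability measures on `[A, B]` with prescribed moments, one
minimizes the integral of a given continuous function. -/
theorem exists_minimizing_weights {ι : Type*} [Fintype ι] {A B : ℝ} {Ψ : ι → ℝ → ℝ} {u : ℝ → ℝ}
    (hΨ : ∀ i, ContinuousOn (Ψ i) (Set.Icc A B)) (hu : ContinuousOn u (Set.Icc A B))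
    (s : Finset ℝ) (p : ℝ → ℝ) (hs : ↑s ⊆ Set.Icc A B) (hp : ∀ x ∈ s, 0 ≤ p x)
    (hp1 : ∑ x ∈ s, p x = 1) :
    ∃ (S : Finset ℝ) (w : ℝ → ℝ), ↑S ⊆ Set.Icc A B ∧ (∀ x ∈ S, 0 < w x) ∧ ∑ x ∈ S, w x = 1 ∧
      (∀ i, ∑ x ∈ S, w x * Ψ i x = ∑ x ∈ s, p x * Ψ i x) ∧
      ∀ (S' : Finset ℝ) (w' : ℝ → ℝ), ↑S' ⊆ Set.Icc A B → (∀ x ∈ S', 0 ≤ w' x) →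
        ∑ x ∈ S', w' x = 1 → (∀ i, ∑ x ∈ S', w' x * Ψ i x = ∑ x ∈ s, p x * Ψ i x) →
        ∑ x ∈ S, w x * u x ≤ ∑ x ∈ S', w' x * u x := by
  set f : ℝ → (ι → ℝ) × ℝ := fun x => (fun i => Ψ i x, u x)
  have hf : ContinuousOn f (Set.Icc A B) := (continuousOn_pi.2 hΨ).prodMk hu
  have hval : ∀ (S : Finset ℝ) (w : ℝ → ℝ), ∑ x ∈ S, w x • f x =
      (fun i => ∑ x ∈ S, w x * Ψ i x, ∑ x ∈ S, w x * u x) := by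
    intro S w
    refine Prod.ext ?_ ?_
    · ext i
      simp [f, Prod.fst_sum]
    · simp [f, Prod.snd_sum]
  set H := convexHull ℝ (f '' Set.Icc A B)
  have hH : IsCompact H := (isCompact_Icc.image_of_continuousOn hf).convexHull_of_finiteDimensional
  have hmem : ∀ (S : Finset ℝ) (w : ℝ → ℝ), ↑S ⊆ Set.Icc A B → (∀ x ∈ S, 0 ≤ w x) →
      ∑ x ∈ S, w x = 1 → ∑ x ∈ S, w x • f x ∈ H := fun S w hS hw hw1 =>
    (convex_convexHull ℝ _).sum_mem hw hw1 fun x hx => subset_convexHull ℝ _ ⟨x, hS hx, rfl⟩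
  set D := H ∩ Prod.fst ⁻¹' {fun i => ∑ x ∈ s, p x * Ψ i x}
  have hD : IsCompact D := hH.inter_right (isClosed_singleton.preimage continuous_fst)
  have hne : D.Nonempty := ⟨_, hmem s p hs hp hp1, by simp [hval]⟩
  obtain ⟨v, ⟨hvH, hvc⟩, hmin⟩ := hD.exists_isMinOn hne continuous_snd.continuousOn
  obtain ⟨S, w, hS, hw, hw1, rfl⟩ := mem_convexHull_image_iff.1 hvH
  refine ⟨S, w, hS, hw, hw1, fun i => ?_, fun S' w' hS' hw' hw1' hc' => ?_⟩
  · rw [hval] at hvc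
    exact congrFun hvc i
  · have hle := hmin (show ∑ x ∈ S', w' x • f x ∈ D from
      ⟨hmem S' w' hS' hw' hw1', by rw [hval]; exact funext hc'⟩)
    simpa [hval] using hle

/-- Existence of a lower representation: a moment point represented by more than `n` points of
`[A, B]` is represented by at most `n + 1` points, one of which is `A`. -/
theorem IsChebyshevSystem.exists_lower_representation {A B : ℝ} (hAB : A < B) {n : ℕ}
    {Ψ : Fin (2 * n + 1) → ℝ → ℝ} {u : ℝ → ℝ} (hΨ0 : ∀ x, Ψ 0 x = 1)
    (hcΨ : ∀ i, ContinuousOn (Ψ i) (Set.Icc A B)) (hcu : ContinuousOn u (Set.Icc A B))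
    (hΨ : IsChebyshevSystem A B Ψ) (hu : IsChebyshevSystem A B (Fin.snoc Ψ u))
    (s : Finset ℝ) (p : ℝ → ℝ) (hs : ↑s ⊆ Set.Icc A B) (hp : ∀ x ∈ s, 0 < p x)
    (hp1 : ∑ x ∈ s, p x = 1) (hcard : n < s.card) :
    ∃ (S : Finset ℝ) (w : ℝ → ℝ), ↑S ⊆ Set.Icc A B ∧ (∀ x ∈ S, 0 < w x) ∧ ∑ x ∈ S, w x = 1 ∧
      S.card ≤ n + 1 ∧ A ∈ S ∧ ∀ i, ∑ x ∈ S, w x * Ψ i x = ∑ x ∈ s, p x * Ψ i x := by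
  obtain ⟨S, w, hS, hw, hw1, hmom, hmin⟩ :=
    exists_minimizing_weights hcΨ hcu s p hs (fun x hx => (hp x hx).le) hp1
  have hSA : ↑(S.erase A) ⊆ Set.Ioc A B := fun x hx => by
    have hx' := Finset.mem_erase.1 hx
    exact ⟨lt_of_le_of_ne (hS hx'.2).1 (Ne.symm hx'.1), (hS hx'.2).2⟩
  have hSn : (S.erase A).card ≤ n := by
    by_contra! hlt
    obtain ⟨Y, hYS, hYc⟩ := Finset.exists_subset_card_eq hlt
    obtain ⟨Z, -, hZs, hZc, -, hodd⟩ :=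
      exists_doubling Y ((Finset.coe_subset.2 hYS).trans hSA) ∅
    have hZI : ↑Z ⊆ Set.Icc A B := hZs.trans Set.Ioc_subset_Icc_self
    obtain ⟨σ, hσ, hσΨ, hσu⟩ :=
      hΨ.exists_annihilator hu Z (by omega) hZI
    obtain ⟨ε, hεS, hε⟩ : ∃ ε : ℝ, (∀ x ∈ S, 0 ≤ w x + ε * σ x) ∧ 0 < ε := by
      have hev : ∀ᶠ ε : ℝ in nhdsWithin 0 (Set.Ioi 0), ∀ x ∈ S, 0 ≤ w x + ε * σ x := by
        refine (Filter.eventually_all_finset S).2 fun x hx => nhdsWithin_le_nhds ?_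
        have ht : Filter.Tendsto (fun ε : ℝ => w x + ε * σ x) (nhds 0) (nhds (w x + 0 * σ x)) :=
          Continuous.tendsto (by fun_prop) 0
        exact (ht.eventually_const_lt (by simpa using hw x hx)).mono fun _ h => h.le
      exact (hev.and self_mem_nhdsWithin).exists
    set w' : ℝ → ℝ := fun x => (if x ∈ S then w x else 0) + ε * (if x ∈ Z then σ x else 0)
    have hsum : ∀ φ : ℝ → ℝ, ∑ x ∈ S ∪ Z, w' x * φ x =
        ∑ x ∈ S, w x * φ x + ε * ∑ x ∈ Z, σ x * φ x := by
      intro φ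
      simp only [w', add_mul, Finset.sum_add_distrib, ite_mul, zero_mul, mul_assoc,
        ← Finset.mul_sum, Finset.sum_ite_mem]
      rw [Finset.union_inter_cancel_left, Finset.union_inter_cancel_right]
    have hw'0 : ∀ x ∈ S ∪ Z, 0 ≤ w' x := by
      intro x hx
      by_cases hxS : x ∈ S <;> by_cases hxZ : x ∈ Z
      · simpa [w', hxS, hxZ] using hεS x hxS
      · simpa [w', hxS, hxZ] using (hw x hxS).le
      · have := hσ x hxZ (hodd x hxZ fun h => hxS (Finset.mem_of_mem_erase (hYS h)))
        simpa [w', hxS, hxZ] using (mul_pos hε this).le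
      · simp [w', hxS, hxZ]
    have hw'm : ∀ i, ∑ x ∈ S ∪ Z, w' x * Ψ i x = ∑ x ∈ s, p x * Ψ i x := fun i => by
      rw [hsum, hσΨ, mul_zero, add_zero, hmom]
    have hle := hmin (S ∪ Z) w' (by simpa using ⟨hS, hZI⟩) hw'0
      (by simpa [hΨ0, hp1] using hw'm 0) hw'm
    rw [hsum] at hle
    nlinarith [mul_pos_of_neg_of_neg (neg_lt_zero.2 hε) hσu]
  refine ⟨S, w, hS, hw, hw1, ?_, ?_, hmom⟩
  · have := Finset.pred_card_le_card_erase (s := S) (a := A)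
    omega
  · by_contra hA
    rw [Finset.erase_eq_of_notMem hA] at hSA hSn
    obtain ⟨X, hSX, hXs, hXc⟩ := exists_superset_card_eq_of_subset_Ioc hAB S hSA hSn
    obtain ⟨Z, hXZ, hZs, hZc, heven, hodd⟩ := exists_doubling X hXs s
    obtain ⟨c, -, hc0, hcpos⟩ :=
      hΨ.exists_combination Z (hZc.trans (by rw [hXc])) (hZs.trans Set.Ioc_subset_Icc_self)
    have hvanish : ∀ x ∈ S, ∑ i, c i * Ψ i x = 0 := fun x hx => hc0 x (hXZ (hSX hx))
    have hsP : ∑ x ∈ s, p x * ∑ i, c i * Ψ i x = 0 := by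
      rw [sum_mul_combination]
      simp_rw [← hmom]
      rw [← sum_mul_combination]
      exact Finset.sum_eq_zero fun x hx => by rw [hvanish x hx, mul_zero]
    have hsX : s ⊆ X := by
      intro x hx
      have hxe := heven x (Finset.mem_union_left _ hx)
      by_contra hxX
      have hxZ : x ∉ Z := fun h => Nat.not_even_iff_odd.2 (hodd x h hxX) hxe
      have hpos := mul_pos (hp x hx) (hcpos x (hs hx) hxZ hxe)
      refine hpos.ne' ((Finset.sum_eq_zero_iff_of_nonneg fun t ht => ?_).1 hsP x hx)
      have hte := heven t (Finset.mem_union_left _ ht)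
      refine mul_nonneg (hp t ht).le ?_
      by_cases htZ : t ∈ Z
      · exact (hc0 t htZ).ge
      · exact (hcpos t (hs ht) htZ hte).le
    have := Finset.card_le_card hsX
    omega

/-- A lower representation minimizes the integral of every function that extends the
Chebyshev system. -/
theorem IsChebyshevSystem.sum_le_of_lower_representation {A B : ℝ} (hAB : A < B) {n : ℕ}
    {Ψ : Fin (2 * n + 1) → ℝ → ℝ} {u : ℝ → ℝ}
    (hΨ : IsChebyshevSystem A B Ψ) (hu : IsChebyshevSystem A B (Fin.snoc Ψ u))
    (s S : Finset ℝ) (p w : ℝ → ℝ) (hs : ↑s ⊆ Set.Icc A B) (hp : ∀ x ∈ s, 0 ≤ p x)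
    (hS : ↑S ⊆ Set.Icc A B) (hScard : S.card ≤ n + 1) (hA : A ∈ S)
    (hmom : ∀ i, ∑ x ∈ S, w x * Ψ i x = ∑ x ∈ s, p x * Ψ i x) :
    ∑ x ∈ S, w x * u x ≤ ∑ x ∈ s, p x * u x := by
  have hSA : ↑(S.erase A) ⊆ Set.Ioc A B := fun x hx => by
    have hx' := Finset.mem_erase.1 hx
    exact ⟨lt_of_le_of_ne (hS hx'.2).1 (Ne.symm hx'.1), (hS hx'.2).2⟩
  have hSn : (S.erase A).card ≤ n := by
    rw [Finset.card_erase_of_mem hA]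
    omega
  obtain ⟨X, hSX, hXs, hXc⟩ := exists_superset_card_eq_of_subset_Ioc hAB _ hSA hSn
  obtain ⟨Z, hXZ, hZs, hZc, heven, -⟩ := exists_doubling X hXs s
  have hAZ : A ∉ Z := fun h => lt_irrefl A (hZs h).1
  obtain ⟨c, hclast, hc0, hcpos⟩ := hu.exists_combination (insert A Z)
    (by rw [Finset.card_insert_of_notMem hAZ, hZc, hXc]) (by
      rw [Finset.coe_insert, Set.insert_subset_iff]
      exact ⟨Set.left_mem_Icc.2 hAB.le, hZs.trans Set.Ioc_subset_Icc_self⟩)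
  have hlast : 0 < c (Fin.last _) := hclast (by simpa using hΨ)
  set P : ℝ → ℝ := fun x => ∑ i, c i * (Fin.snoc Ψ u : Fin (2 * n + 1 + 1) → ℝ → ℝ) i x
  have hPs : 0 ≤ ∑ x ∈ s, p x * P x := by
    refine Finset.sum_nonneg fun x hx => mul_nonneg (hp x hx) ?_
    by_cases hxZ : x ∈ insert A Z
    · exact (hc0 x hxZ).ge
    · refine (hcpos x (hs hx) hxZ ?_).le
      rw [Finset.filter_insert, if_neg (not_lt.2 (hs hx).1)]
      exact heven x (Finset.mem_union_left _ hx)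
  have hPS : ∑ x ∈ S, w x * P x = 0 := by
    refine Finset.sum_eq_zero fun x hx => ?_
    rw [show P x = 0 from hc0 x ?_, mul_zero]
    by_cases hxA : x = A
    · simp [hxA]
    · exact Finset.mem_insert_of_mem (hXZ (hSX (Finset.mem_erase.2 ⟨hxA, hx⟩)))
  simp only [P, sum_mul_combination] at hPs hPS
  simp only [Fin.sum_univ_castSucc (n := 2 * n + 1), Fin.snoc_castSucc, Fin.snoc_last,
    hmom] at hPs hPS
  refine le_of_mul_le_mul_left ?_ hlast
  linarith

theorem integral_sum_smul_dirac (s : Finset ℝ) (a : ℝ → ENNReal) (ha : ∀ x ∈ s, a x ≠ ⊤)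
    (f : ℝ → ℝ) :
    ∫ x, f x ∂(∑ x ∈ s, a x • Measure.dirac x) = ∑ x ∈ s, (a x).toReal * f x := by
  rw [integral_finsetSum_measure fun x hx =>
    (integrable_dirac (by simp)).smul_measure (ha x hx)]
  simp [integral_smul_measure]

theorem IsDesignOn.integral_eq {A B : ℝ} {ξ : Measure ℝ} {s : Finset ℝ} (hξ : IsDesignOn A B ξ s)
    (f : ℝ → ℝ) : ∫ x, f x ∂ξ = ∑ x ∈ s, (ξ {x}).toReal * f x := by
  have := hξ.1
  conv_lhs => rw [hξ.2.2.2]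
  exact integral_sum_smul_dirac s _ (fun x _ => measure_ne_top ξ _) f

/-- Positive weights of total mass one on a finite subset of `[A, B]` define a design. -/
theorem exists_isDesignOn {A B : ℝ} (S : Finset ℝ) (w : ℝ → ℝ) (hS : ↑S ⊆ Set.Icc A B)
    (hw : ∀ x ∈ S, 0 < w x) (hw1 : ∑ x ∈ S, w x = 1) :
    ∃ ξ : Measure ℝ, IsDesignOn A B ξ S ∧ ∀ x ∈ S, (ξ {x}).toReal = w x := by
  set ξ : Measure ℝ := ∑ x ∈ S, ENNReal.ofReal (w x) • Measure.dirac x with hξ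
  have hpt : ∀ x ∈ S, ξ {x} = ENNReal.ofReal (w x) := by
    intro x hx
    simp only [hξ, Measure.finsetSum_apply, Measure.smul_apply, smul_eq_mul]
    rw [Finset.sum_eq_single_of_mem x hx]
    · simp
    · intro y _ hyx
      simp [hyx]
  refine ⟨ξ, ⟨⟨?_⟩, hS, fun x hx => ?_, ?_⟩, fun x hx => ?_⟩
  · simp only [hξ, Measure.finsetSum_apply, Measure.smul_apply, smul_eq_mul, measure_univ, mul_one]
    rw [← ENNReal.ofReal_sum_of_nonneg fun x hx => (hw x hx).le, hw1, ENNReal.ofReal_one]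
  · rw [hpt x hx]
    exact ENNReal.ofReal_pos.2 (hw x hx)
  · exact Finset.sum_congr rfl fun x hx => by rw [hpt x hx]
  · rw [hpt x hx, ENNReal.toReal_ofReal (hw x hx).le]

theorem designIndex_le_card (A B : ℝ) (s : Finset ℝ) : designIndex A B s ≤ s.card := by
  classical
  have hdisj : Disjoint (s.filter fun x => x ∈ Set.Ioo A B)
      (s.filter fun x => x = A ∨ x = B) := by
    refine Finset.disjoint_filter.2 fun x _ hx h => ?_
    rcases h with rfl | rfl
    · exact lt_irrefl _ hx.1
    · exact lt_irrefl _ hx.2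
  have hle := Finset.card_le_card (Finset.union_subset
    (Finset.filter_subset (fun x => x ∈ Set.Ioo A B) s)
    (Finset.filter_subset (fun x => x = A ∨ x = B) s))
  rw [Finset.card_union_of_disjoint hdisj] at hle
  have hle' : ((s.filter fun x => x ∈ Set.Ioo A B).card : ℝ) +
      ((s.filter fun x => x = A ∨ x = B).card : ℝ) ≤ s.card := by exact_mod_cast hle
  have hnn : (0 : ℝ) ≤ ((s.filter fun x => x = A ∨ x = B).card : ℝ) := Nat.cast_nonneg _
  unfold designIndex
  convert (show ((s.filter fun x => x ∈ Set.Ioo A B).card : ℝ) +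
    ((s.filter fun x => x = A ∨ x = B).card : ℝ) / 2 ≤ s.card by linarith)

theorem IsDesignOn.dotProduct_matrixIntegral_mulVec {A B : ℝ} {ξ : Measure ℝ} {s : Finset ℝ}
    (hξ : IsDesignOn A B ξ s) {p₁ : ℕ} (C : ℝ → Matrix (Fin p₁) (Fin p₁) ℝ) (Q : Fin p₁ → ℝ) :
    Q ⬝ᵥ (matrixIntegral C ξ *ᵥ Q) = ∑ x ∈ s, (ξ {x}).toReal * (Q ⬝ᵥ (C x *ᵥ Q)) := by
  have hmat : matrixIntegral C ξ = ∑ x ∈ s, (ξ {x}).toReal • C x := by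
    ext a b
    simp [matrixIntegral, hξ.integral_eq, Matrix.sum_apply]
  simp [hmat, Matrix.sum_mulVec, dotProduct_sum, Matrix.smul_mulVec, dotProduct_smul]

theorem IsDesignOn.isHermitian_matrixIntegral {A B : ℝ} {ξ : Measure ℝ} {s : Finset ℝ}
    (hξ : IsDesignOn A B ξ s) {p₁ : ℕ} {C : ℝ → Matrix (Fin p₁) (Fin p₁) ℝ}
    (hC : ∀ x ∈ Set.Icc A B, (C x).IsSymm) : (matrixIntegral C ξ).IsHermitian := by
  ext a b
  simp only [matrixIntegral, Matrix.conjTranspose_apply, Matrix.of_apply, star_trivial,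
    hξ.integral_eq]
  exact Finset.sum_congr rfl fun x hx => by rw [(hC x (hξ.2.1 hx)).apply]


/-- Yang–Stufken part (2), case (a): in the setting of the complete class theorem
(with `-QᵀC₂₂Q` extensions) with `k` odd and `I(ξ) ≥ k/2`, the dominating design `ξ⁻`
can be chosen with at most `(k+1)/2` support points, one of which is `A`. -/
theorem complete_class_lower_odd
    {k p₁ : ℕ} (hk : 0 < k) (hp : 1 ≤ p₁) (A B : ℝ) (hAB : A < B)
    (Ψ : Fin k → ℝ → ℝ) (C : ℝ → Matrix (Fin p₁) (Fin p₁) ℝ)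
    (hΨ0 : ∀ x : ℝ, Ψ ⟨0, hk⟩ x = 1)
    (hcontΨ : ∀ i, ContinuousOn (Ψ i) (Set.Icc A B))
    (hcontC : ∀ a b, ContinuousOn (fun x => C x a b) (Set.Icc A B))
    (hsymm : ∀ x ∈ Set.Icc A B, (C x).IsSymm)
    (hCheb : IsChebyshevSystem A B Ψ)
    (hChebQ : ∀ Q : Fin p₁ → ℝ, Q ≠ 0 →
      IsChebyshevSystem A B (Fin.snoc Ψ fun x => -(Q ⬝ᵥ ((C x) *ᵥ Q))))
    (ξ : Measure ℝ) (s : Finset ℝ) (hξ : IsDesignOn A B ξ s)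
    (hodd : Odd k) (hidx : (k : ℝ) / 2 ≤ designIndex A B s) :
    ∃ (ξm : Measure ℝ) (sm : Finset ℝ), IsDesignOn A B ξm sm ∧
      sm.card ≤ (k + 1) / 2 ∧ A ∈ sm ∧
      (∀ i, ∫ x, Ψ i x ∂ξm = ∫ x, Ψ i x ∂ξ) ∧
      (matrixIntegral C ξm - matrixIntegral C ξ).PosSemidef := by
  obtain ⟨n, rfl⟩ := hodd
  have hprob := hξ.1
  have hmass : ∀ x ∈ s, 0 < (ξ {x}).toReal := fun x hx =>
    ENNReal.toReal_pos (hξ.2.2.1 x hx).ne' (measure_ne_top ξ _)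
  have hmass1 : ∑ x ∈ s, (ξ {x}).toReal = 1 := by
    have := hξ.integral_eq fun _ => 1
    simpa using this.symm
  have hcard : n < s.card := by
    have h := hidx.trans (designIndex_le_card A B s)
    push_cast at h
    have h' : (n : ℝ) < s.card := by linarith
    exact_mod_cast h'
  have hcontQ : ∀ Q : Fin p₁ → ℝ,
      ContinuousOn (fun x => -(Q ⬝ᵥ ((C x) *ᵥ Q))) (Set.Icc A B) := fun Q => by
    simp only [dotProduct, Matrix.mulVec]
    exact (continuousOn_finsetSum _ fun a _ => continuousOn_const.mul
      (continuousOn_finsetSum _ fun b _ => (hcontC a b).mul continuousOn_const)).neg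
  have hQ₁ : (fun _ => 1 : Fin p₁ → ℝ) ≠ 0 := fun h => one_ne_zero (congrFun h ⟨0, hp⟩)
  obtain ⟨S, w, hS, hw, hw1, hScard, hA, hmom⟩ := hCheb.exists_lower_representation hAB hΨ0 hcontΨ
    (hcontQ _) (hChebQ _ hQ₁) s (fun x => (ξ {x}).toReal) hξ.2.1 hmass hmass1 hcard
  obtain ⟨ξm, hξm, hξmw⟩ := exists_isDesignOn S w hS hw hw1
  have hsum : ∀ φ : ℝ → ℝ, ∑ x ∈ S, (ξm {x}).toReal * φ x = ∑ x ∈ S, w x * φ x := fun φ =>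
    Finset.sum_congr rfl fun x hx => by rw [hξmw x hx]
  refine ⟨ξm, S, hξm, by omega, hA, fun i => ?_, ?_⟩
  · rw [hξm.integral_eq, hξ.integral_eq, hsum, hmom]
  · refine Matrix.PosSemidef.of_dotProduct_mulVec_nonneg
      ((hξm.isHermitian_matrixIntegral hsymm).sub (hξ.isHermitian_matrixIntegral hsymm)) fun Q => ?_
    rcases eq_or_ne Q 0 with rfl | hQ
    · simp
    · have hle := hCheb.sum_le_of_lower_representation hAB (hChebQ Q hQ) s S _ w hξ.2.1
        (fun x hx => (hmass x hx).le) hS hScard hA hmom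
      simp only [mul_neg, Finset.sum_neg_distrib] at hle
      rw [star_trivial, Matrix.sub_mulVec, dotProduct_sub, hξm.dotProduct_matrixIntegral_mulVec,
        hξ.dotProduct_matrixIntegral_mulVec, hsum]
      linarith
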